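/- For every order tree T, every nonempty open subset U of the ray space R(T) contains a nonempty set of the form [t] for some t ∈ T, or contains an isolated point of R(T). In other words, the collection consisting of the nonempty sets [t] (t ∈ T) together with the singletons of isolated points forms a π-base of R(T). -/

import Mathlib

open Set Topology

universe u v

/-- An order tree: a partial order with a minimum element (the root) in which
the set of predecessors of every element is a well-ordered chain. -/
def IsOrderTree (T : Type u) [PartialOrder T] : Prop :=
  (∃ r : T, ∀ t : T, r ≤ t) ∧
    ∀ t : T, IsChain (· ≤ ·) (Set.Iic t) ∧ (Set.Iic t).IsWF

/-- A tree is special if it is the union of countably many antichains. -/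
def IsSpecialTree (T : Type u) [PartialOrder T] : Prop :=
  ∃ A : ℕ → Set T, (∀ n, IsAntichain (· ≤ ·) (A n)) ∧ (⋃ n, A n) = Set.univ

/-- A path of `T`: a down-closed chain. -/
def IsPath {T : Type u} [PartialOrder T] (x : Set T) : Prop :=
  IsChain (· ≤ ·) x ∧ ∀ ⦃s t : T⦄, s ≤ t → t ∈ x → s ∈ x

/-- A ray: a path with no maximal element. -/
def IsRay {T : Type u} [PartialOrder T] (x : Set T) : Prop :=
  IsPath x ∧ ∀ t ∈ x, ∃ s ∈ x, t < s

/-- A branch: an inclusion-wise maximal path. -/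
def IsBranch {T : Type u} [PartialOrder T] (x : Set T) : Prop :=
  IsPath x ∧ ∀ y : Set T, IsPath y → x ⊆ y → y = x

/-- The product topology of `2^T`, transported to `Set T` via characteristic
functions: it is generated by the sets `{s | t ∈ s}` and their complements. -/
def cylinderTopology (T : Type u) : TopologicalSpace (Set T) :=
  TopologicalSpace.generateFrom
    {C : Set (Set T) | ∃ t : T, C = {s : Set T | t ∈ s} ∨ C = {s : Set T | t ∉ s}}

/-- The path space `P(T)`. -/
def PathSpace (T : Type u) [PartialOrder T] : Type u := {x : Set T // IsPath x}

/-- The ray space `R(T)`. -/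
def RaySpace (T : Type u) [PartialOrder T] : Type u := {x : Set T // IsRay x}

/-- The branch space `B(T)`. -/
def BranchSpace (T : Type u) [PartialOrder T] : Type u := {x : Set T // IsBranch x}

instance PathSpace.topologicalSpace (T : Type u) [PartialOrder T] :
    TopologicalSpace (PathSpace T) :=
  TopologicalSpace.induced (fun x => x.1) (cylinderTopology T)

instance RaySpace.topologicalSpace (T : Type u) [PartialOrder T] :
    TopologicalSpace (RaySpace T) :=
  TopologicalSpace.induced (fun x => x.1) (cylinderTopology T)

instance BranchSpace.topologicalSpace (T : Type u) [PartialOrder T] :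
    TopologicalSpace (BranchSpace T) :=
  TopologicalSpace.induced (fun x => x.1) (cylinderTopology T)

/-- The subbasic set `[t] = {x ∈ R(T) : t ∈ x}`. -/
def raySet {T : Type u} [PartialOrder T] (t : T) : Set (RaySpace T) := {x | t ∈ x.1}

/-- The basic set `[t] = {x ∈ B(T) : t ∈ x}`. -/
def branchSet {T : Type u} [PartialOrder T] (t : T) : Set (BranchSpace T) := {x | t ∈ x.1}

/-- A top of a ray `x` is a node whose set of strict predecessors is exactly `x`. -/
def IsTopOf {T : Type u} [PartialOrder T] (t : T) (x : Set T) : Prop := Set.Iio t = x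

/-- `s` is a successor of `t`. -/
def IsSuccessorOf {T : Type u} [PartialOrder T] (s t : T) : Prop :=
  t < s ∧ ∀ u : T, t < u → u < s → False

/-- A tree is pruned if every node has a successor. -/
def IsPruned (T : Type u) [PartialOrder T] : Prop := ∀ t : T, ∃ s : T, IsSuccessorOf s t

/-- A family of sets is nested if any two intersecting members are ⊆-comparable. -/
def NestedFam {X : Type v} (𝒜 : Set (Set X)) : Prop :=
  ∀ A ∈ 𝒜, ∀ B ∈ 𝒜, (A ∩ B).Nonempty → A ⊆ B ∨ B ⊆ A

/-- A family of sets is noetherian if every ⊆-increasing sequence of its members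
is eventually constant. -/
def NoetherianFam {X : Type v} (𝒜 : Set (Set X)) : Prop :=
  ∀ f : ℕ → Set X, (∀ n, f n ∈ 𝒜) → Monotone f → ∃ N, ∀ n, N ≤ n → f n = f N

/-- A family of sets is centered if every finite subfamily has nonempty intersection. -/
def CenteredFam {X : Type v} (𝒜 : Set (Set X)) : Prop :=
  ∀ F : Finset (Set X), ↑F ⊆ 𝒜 → (⋂₀ (F : Set (Set X))).Nonempty

/-- A family of sets is complete if every centered subfamily has nonempty intersection. -/
def CompleteFam {X : Type v} (𝒜 : Set (Set X)) : Prop :=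
  ∀ 𝒞 ⊆ 𝒜, CenteredFam 𝒞 → (⋂₀ 𝒞).Nonempty

/-- A family is hereditarily complete if its trace on every closed set is complete. -/
def HeredCompleteFam {X : Type v} [TopologicalSpace X] (𝒜 : Set (Set X)) : Prop :=
  ∀ Y : Set X, IsClosed Y → CompleteFam {B : Set X | ∃ A ∈ 𝒜, B = A ∩ Y}

/-- A family is σ-disjoint if it is a countable union of pairwise disjoint subfamilies. -/
def SigmaDisjointFam {X : Type v} (𝒜 : Set (Set X)) : Prop :=
  ∃ D : ℕ → Set (Set X), (∀ n, (D n).Pairwise Disjoint) ∧ (⋃ n, D n) = 𝒜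

/-- `S` is a clopen subbase for `X` if the topology of `X` is the coarsest one in which
every member of `S` is clopen, i.e. it is generated by `S` together with the complements
of members of `S`. -/
def IsClopenSubbase {X : Type v} [t : TopologicalSpace X] (S : Set (Set X)) : Prop :=
  t = TopologicalSpace.generateFrom (S ∪ {B : Set X | ∃ A ∈ S, B = Aᶜ})

/-- `B` is a base for the topology of `X`. -/
def IsBaseFam {X : Type v} [TopologicalSpace X] (B : Set (Set X)) : Prop :=
  (∀ U ∈ B, IsOpen U) ∧ ∀ U : Set X, IsOpen U → ∀ x ∈ U, ∃ V ∈ B, x ∈ V ∧ V ⊆ U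

/-- Every neighbourhood of `x` in `2^T` contains a cylinder around `x` given by finite sets. -/
theorem exists_finite_cylinder_subset {T : Type u} {V : Set (Set T)}
    (hV : IsOpen[cylinderTopology T] V) {x : Set T} (hx : x ∈ V) :
    ∃ F G : Set T, F.Finite ∧ G.Finite ∧ F ⊆ x ∧ Disjoint G x ∧
      ∀ y : Set T, F ⊆ y → Disjoint G y → y ∈ V := by
  induction hV with
  | basic C hC =>
    obtain ⟨t, rfl | rfl⟩ := hC
    · exact ⟨{t}, ∅, finite_singleton t, finite_empty, by simpa using hx, by simp,
        fun y hy _ => hy rfl⟩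
    · exact ⟨∅, {t}, finite_empty, finite_singleton t, by simp, by simpa using hx,
        fun y _ hy => by simpa using hy⟩
  | univ => exact ⟨∅, ∅, finite_empty, finite_empty, by simp, by simp, fun _ _ _ => trivial⟩
  | inter A B _ _ ihA ihB =>
    obtain ⟨F, G, hF, hG, hFx, hGx, h⟩ := ihA hx.1
    obtain ⟨F', G', hF', hG', hFx', hGx', h'⟩ := ihB hx.2
    refine ⟨F ∪ F', G ∪ G', hF.union hF', hG.union hG', union_subset hFx hFx',
      disjoint_union_left.2 ⟨hGx, hGx'⟩, fun y hy hGy => ?_⟩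
    rw [disjoint_union_left] at hGy
    exact ⟨h y (subset_union_left.trans hy) hGy.1, h' y (subset_union_right.trans hy) hGy.2⟩
  | sUnion S _ ih =>
    obtain ⟨A, hA, hxA⟩ := hx
    obtain ⟨F, G, hF, hG, hFx, hGx, h⟩ := ih A hA hxA
    exact ⟨F, G, hF, hG, hFx, hGx, fun y hy hGy => ⟨A, hA, h y hy hGy⟩⟩

theorem isOpen_raySet {T : Type u} [PartialOrder T] (t : T) : IsOpen (raySet t) :=
  ⟨{s | t ∈ s}, TopologicalSpace.isOpen_generateFrom_of_mem ⟨t, Or.inl rfl⟩, rfl⟩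

theorem isOpen_compl_raySet {T : Type u} [PartialOrder T] (t : T) : IsOpen (raySet t)ᶜ :=
  ⟨{s | t ∉ s}, TopologicalSpace.isOpen_generateFrom_of_mem ⟨t, Or.inr rfl⟩, rfl⟩

theorem IsPath.le_or_le {T : Type u} [PartialOrder T] {x : Set T} (hx : IsPath x) {s t : T}
    (hs : s ∈ x) (ht : t ∈ x) : s ≤ t ∨ t ≤ s :=
  hx.1.total hs ht

/-- In an order tree, every nonempty subset of a principal down-set has a least element. -/
theorem IsOrderTree.exists_isLeast {T : Type u} [PartialOrder T] (hT : IsOrderTree T) {g : T}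
    {S : Set T} (hS : S.Nonempty) (hSg : S ⊆ Iic g) : ∃ m, IsLeast S m := by
  have hwf : S.IsWF := (hT.2 g).2.mono hSg
  refine ⟨hwf.min hS, hwf.min_mem hS, fun a ha => ?_⟩
  rcases (hT.2 g).1.total (hSg (hwf.min_mem hS)) (hSg ha) with h | h
  · exact h
  · exact (h.eq_of_not_lt (hwf.not_lt_min hS ha)).ge

/-- In an order tree, every nonempty subset of a path has a least element. -/
theorem IsPath.exists_isLeast {T : Type u} [PartialOrder T] (hT : IsOrderTree T) {x : Set T}
    (hx : IsPath x) {S : Set T} (hS : S.Nonempty) (hSx : S ⊆ x) : ∃ m, IsLeast S m := by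
  obtain ⟨g, hg⟩ := hS
  obtain ⟨m, hm, hle⟩ := hT.exists_isLeast (S := S ∩ Iic g) ⟨g, hg, le_rfl⟩ inter_subset_right
  refine ⟨m, hm.1, fun a ha => ?_⟩
  rcases hx.le_or_le (hSx ha) (hSx hg) with h | h
  · exact hle ⟨ha, h⟩
  · exact hm.2.trans h

/-- Among the rays included in a given ray and including a given set there is a minimal one. -/
theorem IsRay.exists_minimal_superset {T : Type u} [PartialOrder T] (hT : IsOrderTree T)
    {x F : Set T} (hx : IsRay x) (hF : F ⊆ x) :
    ∃ z ⊆ x, IsRay z ∧ F ⊆ z ∧ ∀ y, IsRay y → F ⊆ y → y ⊆ z → y = z := by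
  rcases {u ∈ x | ∃ z ⊆ x, IsRay z ∧ F ⊆ z ∧ u ∉ z}.eq_empty_or_nonempty with hS | hS
  · refine ⟨x, Subset.rfl, hx, hF, fun y hy hFy hyx => hyx.antisymm fun u hu => ?_⟩
    by_contra huy
    exact (hS.subset ⟨hu, y, hyx, hy, hFy, huy⟩ : u ∈ (∅ : Set T))
  · obtain ⟨u, ⟨-, z, hzx, hz, hFz, huz⟩, hle⟩ := hx.1.exists_isLeast hT hS (sep_subset _ _)
    refine ⟨z, hzx, hz, hFz, fun y hy hFy hyz => hyz.antisymm fun w hw => ?_⟩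
    by_contra hwy
    exact huz (hz.1.2 (hle ⟨hzx hw, y, hyz.trans hzx, hy, hFy, hwy⟩) hw)

/-- Every nonempty open subset of `R(T)` contains a nonempty set `[t]` for
some `t ∈ T`, or contains an isolated point of `R(T)`. -/
theorem stmt9 {T : Type u} [PartialOrder T] (hT : IsOrderTree T) :
    ∀ U : Set (RaySpace T), IsOpen U → U.Nonempty →
      (∃ t : T, (raySet t).Nonempty ∧ raySet t ⊆ U) ∨
      (∃ x : RaySpace T, IsOpen ({x} : Set (RaySpace T)) ∧ x ∈ U) := by
  rintro U ⟨V, hV, rfl⟩ ⟨x₀, hx₀⟩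
  obtain ⟨F, G, hF, hG, hFx₀, hGx₀, hFG⟩ := exists_finite_cylinder_subset hV hx₀
  obtain ⟨x, hxx₀, hx, hFx, hmin⟩ := x₀.2.exists_minimal_superset hT hFx₀
  have hGx : Disjoint G x := hGx₀.mono_right hxx₀
  refine or_iff_not_imp_left.2 fun hno => ⟨⟨x, hx⟩, ?_, hFG x hFx hGx⟩
  have hleast : ∀ g ∈ G, ∃ m, IsLeast (Iic g \ x) m := fun g hg =>
    hT.exists_isLeast ⟨g, le_rfl, fun h => hGx.notMem_of_mem_left hg h⟩ sdiff_subset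
  choose! m hm using hleast
  have hsingle : ({⟨x, hx⟩} : Set (RaySpace T)) =
      (⋂ f ∈ F, raySet f) ∩ ⋂ g ∈ G, (raySet (m g))ᶜ := by
    ext y
    constructor
    · rintro rfl
      exact ⟨mem_iInter₂.2 fun f hf => hFx hf, mem_iInter₂.2 fun g hg => (hm g hg).1.2⟩
    · rintro ⟨hyF, hyG⟩
      rw [mem_iInter₂] at hyF hyG
      refine Subtype.ext (hmin y.1 y.2 hyF fun v hvy => ?_)
      by_contra hvx
      refine hno ⟨v, ⟨y, hvy⟩, fun z hvz => hFG z.1 (fun f hf => ?_) ?_⟩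
      · rcases y.2.1.le_or_le (hyF f hf) hvy with h | h
        · exact z.2.1.2 h hvz
        · exact absurd (hx.1.2 h (hFx hf)) hvx
      · refine disjoint_left.2 fun g hg hgz => hyG g hg (y.2.1.2 ?_ hvy)
        rcases z.2.1.le_or_le hvz hgz with h | h
        · exact (hm g hg).2 ⟨h, hvx⟩
        · exact (hm g hg).1.1.trans h
  rw [hsingle]
  exact (hF.isOpen_biInter fun f _ => isOpen_raySet f).inter
    (hG.isOpen_biInter fun g _ => isOpen_compl_raySet (m g))
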